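/- For every real y with 0 ≤ y and (1-q)·y < 1, the series identity ∑_{k=0}^∞ [k]_q²·P_k(q;y)/[k]_q! = A(1)·(q·y² + y)·e_q^y + 2·q·y·D_qA(1)·e_q^{qy} + (q·D_q²A(1) + D_qA(1))·e_q^{q²y} holds. -/

import Mathlib

open Filter

/-- The `q`-integer `[n]_q = (1 - q^n)/(1 - q)`. -/
noncomputable def qInt (q : ℝ) (n : ℕ) : ℝ := (1 - q ^ n) / (1 - q)

/-- The `q`-factorial `[n]_q! = [1]_q [2]_q ⋯ [n]_q`, with `[0]_q! = 1`. -/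
noncomputable def qFact (q : ℝ) (n : ℕ) : ℝ := ∏ i ∈ Finset.range n, qInt q (i + 1)

/-- The `q`-exponential `e_q^x = ∑ x^n/[n]_q!`. -/
noncomputable def qExp (q x : ℝ) : ℝ := ∑' n : ℕ, x ^ n / qFact q n

/-- The `q`-exponential `E_q^x = ∑ q^{n(n-1)/2} x^n/[n]_q!`. -/
noncomputable def qExpE (q x : ℝ) : ℝ := ∑' n : ℕ, q ^ (n * (n - 1) / 2) * x ^ n / qFact q n

/-- The power series `A(u) = ∑ c_k u^k`. -/
noncomputable def APow (c : ℕ → ℝ) (u : ℝ) : ℝ := ∑' k : ℕ, c k * u ^ k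

/-- The `q`-Appell polynomial `P_k(q;y) = [k]_q! ∑_{j=0}^k c_j y^{k-j}/[k-j]_q!`. -/
noncomputable def qAppell (c : ℕ → ℝ) (q y : ℝ) (k : ℕ) : ℝ :=
  qFact q k * ∑ j ∈ Finset.range (k + 1), c j * y ^ (k - j) / qFact q (k - j)

/-- `D_q A(1) = (A(1) - A(q))/(1-q)`. -/
noncomputable def DqA1 (c : ℕ → ℝ) (q : ℝ) : ℝ := (APow c 1 - APow c q) / (1 - q)

/-- `D_q A(q) = (A(q) - A(q²))/((1-q) q)`. -/
noncomputable def DqAq (c : ℕ → ℝ) (q : ℝ) : ℝ := (APow c q - APow c (q ^ 2)) / ((1 - q) * q)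

/-- `D_q² A(1) = (D_q A(1) - D_q A(q))/(1-q)`. -/
noncomputable def Dq2A1 (c : ℕ → ℝ) (q : ℝ) : ℝ := (DqA1 c q - DqAq c q) / (1 - q)

/-- The Stancu-type `q`-Favard–Szász operator `T_{n,t}^{α,β}(f;q;x)`. -/
noncomputable def Tq (c : ℕ → ℝ) (q : ℝ) (n : ℕ) (t α β : ℝ) (f : ℝ → ℝ) (x : ℝ) : ℝ :=
  qExpE q (-(qInt q n * t)) / APow c 1 *
    ∑' k : ℕ, qAppell c q (qInt q n * t) k / qFact q k *
      f (x + (qInt q k + α) / (qInt q n + β))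

/-- Statistical convergence of a real sequence to `l`. -/
def StatLim (x : ℕ → ℝ) (l : ℝ) : Prop :=
  ∀ ε > 0, Tendsto
    (fun n : ℕ => (((Finset.Icc 1 n).filter fun k => ε ≤ |x k - l|).card : ℝ) / n)
    atTop (nhds 0)

/-- Modulus of continuity of `f` on `[0,∞)`. -/
noncomputable def modCont (f : ℝ → ℝ) (δ : ℝ) : ℝ :=
  sSup {r : ℝ | ∃ u v : ℝ, 0 ≤ u ∧ 0 ≤ v ∧ |u - v| ≤ δ ∧ r = |f u - f v|}

/-- Second-order modulus of smoothness of `f` on `[0,∞)`. -/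
noncomputable def mod2 (f : ℝ → ℝ) (δ : ℝ) : ℝ :=
  sSup {r : ℝ | ∃ h x : ℝ, 0 < h ∧ h ≤ δ ∧ 0 ≤ x ∧
    r = |f (x + 2 * h) - 2 * f (x + h) + f x|}

lemma qInt_succ_pos (q : ℝ) (hq0 : 0 < q) (hq1 : q < 1) (n : ℕ) : 0 < qInt q (n + 1) := by
  unfold qInt
  have : q ^ (n + 1) < 1 := pow_lt_one₀ hq0.le hq1 (by omega)
  exact div_pos (by linarith) (by linarith)

lemma qFact_pos (q : ℝ) (hq0 : 0 < q) (hq1 : q < 1) (n : ℕ) : 0 < qFact q n := by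
  unfold qFact
  exact Finset.prod_pos fun i _ => qInt_succ_pos q hq0 hq1 i

lemma qFact_succ (q : ℝ) (n : ℕ) : qFact q (n + 1) = qFact q n * qInt q (n + 1) := by
  unfold qFact
  rw [Finset.prod_range_succ]

lemma qExp_summable (q : ℝ) (hq0 : 0 < q) (hq1 : q < 1) (x : ℝ) (hx0 : 0 ≤ x)
    (hx1 : (1 - q) * x < 1) : Summable fun n : ℕ => x ^ n / qFact q n := by
  obtain ⟨r, hr1, hr2⟩ := exists_between hx1
  have hlim : Tendsto (fun n : ℕ => r * ((1 - q ^ (n + 1)))) atTop (nhds (r * (1 - 0))) := by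
    have := (tendsto_pow_atTop_nhds_zero_of_lt_one hq0.le hq1).comp (tendsto_add_atTop_nat 1)
    exact (this.const_sub 1).const_mul r
  refine summable_of_ratio_norm_eventually_le (r := r) hr2 ?_
  filter_upwards [hlim.eventually_const_lt (u := (1 - q) * x) (by simpa using hr1)] with n hn
  have h1 := qFact_pos q hq0 hq1 n
  have h2 := qInt_succ_pos q hq0 hq1 n
  have h3 := qFact_pos q hq0 hq1 (n + 1)
  rw [Real.norm_of_nonneg (by positivity), Real.norm_of_nonneg (by positivity), qFact_succ]
  have h4 : x ≤ r * qInt q (n + 1) := by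
    unfold qInt
    rw [← mul_div_assoc, le_div_iff₀ (by linarith)]
    linarith
  have h5 : x ^ (n + 1) / (qFact q n * qInt q (n + 1))
      = x ^ n / qFact q n * (x / qInt q (n + 1)) := by
    field_simp
    ring
  rw [h5, mul_comm]
  refine mul_le_mul_of_nonneg_right ?_ (by positivity)
  rwa [div_le_iff₀ h2]

lemma qExp_func (q : ℝ) (hq0 : 0 < q) (hq1 : q < 1) (x : ℝ) (hx0 : 0 ≤ x)
    (hx1 : (1 - q) * x < 1) : qExp q (q * x) = (1 - (1 - q) * x) * qExp q x := by
  have hs := qExp_summable q hq0 hq1 x hx0 hx1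
  have hs' := qExp_summable q hq0 hq1 (q * x) (by positivity)
    (by nlinarith [mul_nonneg (sub_nonneg.2 hq1.le) hx0])
  have h := (hs.sub hs').tsum_eq_zero_add
  rw [hs.tsum_sub hs'] at h
  have h2 : ∀ n : ℕ, x ^ (n + 1) / qFact q (n + 1) - (q * x) ^ (n + 1) / qFact q (n + 1)
      = (1 - q) * x * (x ^ n / qFact q n) := by
    intro n
    have h1 := qFact_pos q hq0 hq1 n
    have h2 := qInt_succ_pos q hq0 hq1 n
    have h3 : 1 - q ^ (n + 1) = (1 - q) * qInt q (n + 1) := by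
      unfold qInt
      field_simp [show (1 - q) ≠ 0 by linarith]
    rw [qFact_succ, ← sub_div, mul_pow,
      show x ^ (n + 1) - q ^ (n + 1) * x ^ (n + 1) = (1 - q ^ (n + 1)) * x ^ (n + 1) by ring, h3]
    field_simp
    ring
  simp only [h2, tsum_mul_left, pow_zero, sub_self, zero_add] at h
  unfold qExp
  linarith

lemma appell_gen (q : ℝ) (hq0 : 0 < q) (hq1 : q < 1)
    (c : ℕ → ℝ) (hc : ∀ k, 0 ≤ c k)
    (hrad : ∃ R : ℝ, 1 < R ∧ Summable fun k => c k * R ^ k)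
    (y : ℝ) (hy0 : 0 ≤ y) (hy1 : (1 - q) * y < 1) (u : ℝ) (hu0 : 0 ≤ u) (hu1 : u ≤ 1) :
    HasSum (fun k : ℕ => u ^ k * (qAppell c q y k / qFact q k)) (APow c u * qExp q (u * y)) := by
  obtain ⟨R, hR, hsR⟩ := hrad
  have hsA : Summable fun k => c k * u ^ k := by
    refine hsR.of_nonneg_of_le (fun k => mul_nonneg (hc k) (by positivity)) fun k => ?_
    exact mul_le_mul_of_nonneg_left (pow_le_pow_left₀ hu0 (by linarith) k) (hc k)
  have hsE := qExp_summable q hq0 hq1 (u * y) (by positivity)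
    (by nlinarith [mul_nonneg (mul_nonneg (sub_nonneg.2 hq1.le) hy0) (sub_nonneg.2 hu1)])
  have key : (fun k : ℕ => u ^ k * (qAppell c q y k / qFact q k)) = fun n =>
      ∑ k ∈ Finset.range (n + 1), (c k * u ^ k) * ((u * y) ^ (n - k) / qFact q (n - k)) := by
    funext n
    unfold qAppell
    rw [mul_div_cancel_left₀ _ (qFact_pos q hq0 hq1 n).ne', Finset.mul_sum]
    refine Finset.sum_congr rfl fun j hj => ?_
    have hj' : j ≤ n := by simpa [Nat.lt_succ_iff] using hj
    have : u ^ n = u ^ j * u ^ (n - j) := by rw [← pow_add]; congr 1; omega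
    rw [this, mul_pow]
    ring
  rw [key]
  have h1 := (summable_norm_sum_mul_range_of_summable_norm hsA.norm hsE.norm).of_norm
  unfold APow qExp
  rw [tsum_mul_tsum_eq_tsum_sum_range_of_summable_norm hsA.norm hsE.norm]
  exact h1.hasSum

/-- `∑_{k=0}^∞ [k]_q² P_k(q;y)/[k]_q!
    = A(1)(qy² + y) e_q^y + 2qy D_qA(1) e_q^{qy} + (q D_q²A(1) + D_qA(1)) e_q^{q²y}`. -/
theorem stmt_2 (q : ℝ) (hq0 : 0 < q) (hq1 : q < 1)
    (c : ℕ → ℝ) (hc : ∀ k, 0 ≤ c k)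
    (hrad : ∃ R : ℝ, 1 < R ∧ Summable fun k => c k * R ^ k) (hA1 : 0 < APow c 1)
    (y : ℝ) (hy0 : 0 ≤ y) (hy1 : (1 - q) * y < 1) :
    ∑' k : ℕ, (qInt q k) ^ 2 * qAppell c q y k / qFact q k =
      APow c 1 * (q * y ^ 2 + y) * qExp q y
        + 2 * q * y * DqA1 c q * qExp q (q * y)
        + (q * Dq2A1 c q + DqA1 c q) * qExp q (q ^ 2 * y) := by
  have h1q : (1 - q) ≠ 0 := by linarith
  have g1 := appell_gen q hq0 hq1 c hc hrad y hy0 hy1 1 zero_le_one le_rfl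
  have g2 := appell_gen q hq0 hq1 c hc hrad y hy0 hy1 q hq0.le hq1.le
  have g3 := appell_gen q hq0 hq1 c hc hrad y hy0 hy1 (q ^ 2) (by positivity)
    (pow_le_one₀ hq0.le hq1.le)
  have f1 := qExp_func q hq0 hq1 y hy0 hy1
  have f2 := qExp_func q hq0 hq1 (q * y) (by positivity)
    (by nlinarith [mul_nonneg (sub_nonneg.2 hq1.le) hy0])
  rw [← mul_assoc, ← pow_two] at f2
  have G := ((g1.sub (g2.mul_left 2)).add g3).div_const ((1 - q) ^ 2)
  have hfun : (fun k : ℕ => (qInt q k) ^ 2 * qAppell c q y k / qFact q k) = fun k =>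
      (1 ^ k * (qAppell c q y k / qFact q k) - 2 * (q ^ k * (qAppell c q y k / qFact q k))
        + (q ^ 2) ^ k * (qAppell c q y k / qFact q k)) / (1 - q) ^ 2 := by
    funext k
    unfold qInt
    rw [one_pow, ← pow_mul, mul_comm 2 k, pow_mul, div_pow]
    ring
  rw [hfun, G.tsum_eq, one_mul]
  unfold Dq2A1 DqA1 DqAq
  rw [f2, f1]
  field_simp
  ring
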